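/- arXiv:1410.2727 — 9 statements merged into one kernel-verified Lean document; each statement's English description precedes it below -/
import Mathlib

section
/- Assume the finite-dimensional distributions of X are weakly continuous. If (c_n)_{n∈ℕ} is a sequence in the dilative decomposability group D_X(α,δ) with c_n → c for some c>0, then c ∈ D_X(α,δ); i.e. D_X(α,δ) is a closed subset of (0,∞). -/
open MeasureTheory ProbabilityTheory Filter Topology

noncomputable section

/-- The `n`-fold convolution power of a measure on `Fin k → ℝ`. -/
def ConvPow {k : ℕ} (ν : Measure (Fin k → ℝ)) : ℕ → Measure (Fin k → ℝ)
  | 0 => Measure.dirac 0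
  | n + 1 => ((ConvPow ν n).prod ν).map fun p => p.1 + p.2

/-- A measure on `Fin k → ℝ` is infinitely divisible if for every `n ≥ 1` it is the
`n`-fold convolution power of some probability measure. -/
def InfinitelyDivisible {k : ℕ} (μ : Measure (Fin k → ℝ)) : Prop :=
  ∀ n : ℕ, 0 < n → ∃ ν : Measure (Fin k → ℝ), IsProbabilityMeasure ν ∧ μ = ConvPow ν n

/-- Membership of `c > 0` in the dilative decomposability group `D_X(α,δ)`, expressed via
the family `ψ` of log-characteristic functions of the finite-dimensional distributions
(indexed by the dimension `k`, the time vector `t ∈ 𝕋^k` and the argument `θ ∈ ℝ^k`). -/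
def MemDilDecompGroup (T : Set ℝ) (ψ : ∀ k : ℕ, (Fin k → ℝ) → (Fin k → ℝ) → ℂ)
    (α δ c : ℝ) : Prop :=
  0 < c ∧ ∀ (k : ℕ) (t θ : Fin k → ℝ), (∀ j, t j ∈ T) →
    ψ k (fun j => c * t j) θ =
      ((c ^ δ : ℝ) : ℂ) * ψ k t (fun j => c ^ (α - δ / 2) * θ j)


/-- A logarithm of a given function on a preconnected space is determined by its continuity and its
value at one point. -/
theorem eq_of_cexp_eq {E : Type*} [TopologicalSpace E] [PreconnectedSpace E] {f g : E → ℂ}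
    (hf : Continuous f) (hg : Continuous g) (h : ∀ x, Complex.exp (f x) = Complex.exp (g x))
    {a : E} (ha : f a = g a) : f = g :=
  Complex.isCoveringMap_exp.eq_of_comp_eq hf hg (funext fun x => Subtype.ext (h x)) a ha

/-- The integral of `exp (i f)` in terms of the integrals of `cos f` and `sin f`. -/
theorem integral_cexp_I_mul {Ω : Type*} [MeasurableSpace Ω] {P : Measure Ω}
    [IsProbabilityMeasure P] {f : Ω → ℝ} (hf : Measurable f) :
    ∫ ω, Complex.exp (Complex.I * (f ω : ℂ)) ∂P =
      ((∫ ω, Real.cos (f ω) ∂P : ℝ) : ℂ) + ((∫ ω, Real.sin (f ω) ∂P : ℝ) : ℂ) * Complex.I := by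
  have hcos : Integrable (fun ω => Real.cos (f ω)) P :=
    .of_bound (by fun_prop) 1 (.of_forall fun ω => by simpa using Real.abs_cos_le_one (f ω))
  have hsin : Integrable (fun ω => Real.sin (f ω)) P :=
    .of_bound (by fun_prop) 1 (.of_forall fun ω => by simpa using Real.abs_sin_le_one (f ω))
  rw [← integral_complex_ofReal, ← integral_complex_ofReal, ← integral_mul_const,
    ← integral_add hcos.ofReal (hsin.ofReal.mul_const _)]
  refine integral_congr_ae (.of_forall fun ω => ?_)
  simp [mul_comm Complex.I, Complex.exp_mul_I]

/-- Weak continuity of the finite-dimensional distributions implies continuity of the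
characteristic functions in the time vector. -/
theorem continuousOn_integral_cexp {Ω : Type*} [MeasurableSpace Ω] {P : Measure Ω}
    [IsProbabilityMeasure P] {X : ℝ → Ω → ℝ} (hX : ∀ s, Measurable (X s)) {k : ℕ}
    {S : Set (Fin k → ℝ)}
    (hWC : ∀ g : BoundedContinuousFunction (Fin k → ℝ) ℝ,
      ContinuousOn (fun t : Fin k → ℝ => ∫ ω, g (fun j => X (t j) ω) ∂P) S) (θ : Fin k → ℝ) :
    ContinuousOn (fun t : Fin k → ℝ =>
      ∫ ω, Complex.exp (Complex.I * ((∑ j, θ j * X (t j) ω : ℝ) : ℂ)) ∂P) S := by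
  have hcos := hWC (.ofNormedAddCommGroup (fun x => Real.cos (∑ j, θ j * x j)) (by fun_prop) 1
    fun x => by simpa using Real.abs_cos_le_one _)
  have hsin := hWC (.ofNormedAddCommGroup (fun x => Real.sin (∑ j, θ j * x j)) (by fun_prop) 1
    fun x => by simpa using Real.abs_sin_le_one _)
  have hmeas (t : Fin k → ℝ) : Measurable fun ω => ∑ j, θ j * X (t j) ω :=
    Finset.measurable_sum _ fun j _ => (hX (t j)).const_mul _
  simp only [integral_cexp_I_mul (hmeas _)]
  exact (Complex.continuous_ofReal.comp_continuousOn hcos).add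
    ((Complex.continuous_ofReal.comp_continuousOn hsin).mul continuousOn_const)

/-- If the finite-dimensional distributions of `X` are weakly continuous and `(cₙ)` is a
sequence in `D_X(α,δ)` with `cₙ → c > 0`, then `c ∈ D_X(α,δ)`: the dilative
decomposability group is a closed subset of `(0,∞)`. -/
theorem dilDecompGroup_closed
    (T : Set ℝ) (hT : T = Set.univ ∨ T = Set.Ici 0 ∨ T = Set.Ioi 0)
    (Ω : Type*) [MeasurableSpace Ω] (P : Measure Ω) [IsProbabilityMeasure P]
    (X : ℝ → Ω → ℝ) (hXmeas : ∀ s : ℝ, Measurable (X s))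
    (ψ : ∀ k : ℕ, (Fin k → ℝ) → (Fin k → ℝ) → ℂ)
    (hψ0 : ∀ (k : ℕ) (t : Fin k → ℝ), ψ k t 0 = 0)
    (hψcont : ∀ (k : ℕ) (t : Fin k → ℝ), Continuous (ψ k t))
    (hchar : ∀ (k : ℕ) (t : Fin k → ℝ), (∀ j, t j ∈ T) → ∀ θ : Fin k → ℝ,
      Complex.exp (ψ k t θ) =
        ∫ ω, Complex.exp (Complex.I * ((∑ j, θ j * X (t j) ω : ℝ) : ℂ)) ∂P)
    (hID : ∀ (k : ℕ) (t : Fin k → ℝ), (∀ j, t j ∈ T) →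
      InfinitelyDivisible (P.map fun ω j => X (t j) ω))
    -- weak continuity of the finite-dimensional distributions of `X`:
    (hWC : ∀ (k : ℕ) (g : BoundedContinuousFunction (Fin k → ℝ) ℝ),
      ContinuousOn (fun t : Fin k → ℝ => ∫ ω, g (fun j => X (t j) ω) ∂P)
        {t : Fin k → ℝ | ∀ j, t j ∈ T})
    (α δ : ℝ) (cs : ℕ → ℝ) (hcs : ∀ n, MemDilDecompGroup T ψ α δ (cs n))
    (c : ℝ) (hcpos : 0 < c) (hlim : Tendsto cs atTop (nhds c)) :
    MemDilDecompGroup T ψ α δ c := by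
  refine ⟨hcpos, fun k t θ ht => ?_⟩
  have hmul {a : ℝ} (ha : 0 < a) (j : Fin k) : a * t j ∈ T := by
    have := ht j
    rcases hT with rfl | rfl | rfl
    · trivial
    · exact mul_nonneg ha.le this
    · exact mul_pos ha this
  refine congrFun (eq_of_cexp_eq (f := ψ k fun j => c * t j)
    (g := fun θ => ((c ^ δ : ℝ) : ℂ) * ψ k t (fun j => c ^ (α - δ / 2) * θ j)) (hψcont _ _)
    (continuous_const.mul ((hψcont k t).comp (by fun_prop))) (fun θ => ?_) (a := 0) ?_) θ
  · have hleft : Tendsto (fun n => Complex.exp (ψ k (fun j => cs n * t j) θ)) atTop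
        (𝓝 (Complex.exp (ψ k (fun j => c * t j) θ))) := by
      simp only [hchar k _ (hmul (hcs _).1), hchar k _ (hmul hcpos)]
      refine (continuousOn_integral_cexp hXmeas (hWC k) θ _ (hmul hcpos)).tendsto.comp
        (tendsto_nhdsWithin_iff.2 ⟨?_, .of_forall fun n => hmul (hcs n).1⟩)
      exact tendsto_pi_nhds.2 fun j => hlim.mul_const _
    have hpow (p : ℝ) : Tendsto (fun n => cs n ^ p) atTop (𝓝 (c ^ p)) :=
      hlim.rpow_const (.inl hcpos.ne')
    have hright : Tendsto (fun n => Complex.exp (((cs n ^ δ : ℝ) : ℂ) *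
        ψ k t (fun j => cs n ^ (α - δ / 2) * θ j))) atTop
        (𝓝 (Complex.exp (((c ^ δ : ℝ) : ℂ) * ψ k t (fun j => c ^ (α - δ / 2) * θ j)))) := by
      refine (Complex.continuous_exp.tendsto _).comp
        (((Complex.continuous_ofReal.tendsto _).comp (hpow δ)).mul
          (((hψcont k t).tendsto _).comp ?_))
      exact tendsto_pi_nhds.2 fun j => (hpow _).mul_const _
    simp only [(hcs _).2 k t θ ht] at hleft
    exact tendsto_nhds_unique hleft hright
  · have hzero : (fun _ : Fin k => (0 : ℝ)) = 0 := rfl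
    simp [hψ0, hzero]
end
end

section
/- Suppose the time set 𝕋 is closed under multiplication by positive reals (e.g. 𝕋 = ℝ, [0,∞) or (0,∞)). If c belongs to the dilative decomposability group D_X(α,δ), then so does c^{-1}; consequently D_X(α,δ) is a subgroup of the multiplicative group ((0,∞),·). -/
open MeasureTheory ProbabilityTheory Filter Topology

noncomputable section

/-- If the time set `𝕋` is closed under multiplication by positive reals and
`c ∈ D_X(α,δ)`, then also `c⁻¹ ∈ D_X(α,δ)`; consequently (together with closedness under
multiplication and `1 ∈ D_X(α,δ)`) the dilative decomposability group is a subgroup of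
the multiplicative group `((0,∞),·)`. -/
theorem dilDecompGroup_inv
    (T : Set ℝ) (hT : ∀ a : ℝ, 0 < a → ∀ s ∈ T, a * s ∈ T)
    (Ω : Type*) [MeasurableSpace Ω] (P : Measure Ω) [IsProbabilityMeasure P]
    (X : ℝ → Ω → ℝ) (hXmeas : ∀ s : ℝ, Measurable (X s))
    (ψ : ∀ k : ℕ, (Fin k → ℝ) → (Fin k → ℝ) → ℂ)
    (hψ0 : ∀ (k : ℕ) (t : Fin k → ℝ), ψ k t 0 = 0)
    (hψcont : ∀ (k : ℕ) (t : Fin k → ℝ), Continuous (ψ k t))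
    (hchar : ∀ (k : ℕ) (t : Fin k → ℝ), (∀ j, t j ∈ T) → ∀ θ : Fin k → ℝ,
      Complex.exp (ψ k t θ) =
        ∫ ω, Complex.exp (Complex.I * ((∑ j, θ j * X (t j) ω : ℝ) : ℂ)) ∂P)
    (hID : ∀ (k : ℕ) (t : Fin k → ℝ), (∀ j, t j ∈ T) →
      InfinitelyDivisible (P.map fun ω j => X (t j) ω))
    (α δ c : ℝ) (hc : MemDilDecompGroup T ψ α δ c) :
    MemDilDecompGroup T ψ α δ c⁻¹ := by
  obtain ⟨hc0, h⟩ := hc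
  refine ⟨inv_pos.mpr hc0, fun k t θ ht => ?_⟩
  have key := h k (fun j => c⁻¹ * t j) (fun j => c⁻¹ ^ (α - δ / 2) * θ j)
    fun j => hT c⁻¹ (inv_pos.mpr hc0) (t j) (ht j)
  have hcancel : c ^ (α - δ / 2) * c⁻¹ ^ (α - δ / 2) = 1 := by
    rw [← Real.mul_rpow hc0.le (inv_pos.mpr hc0).le, mul_inv_cancel₀ hc0.ne', Real.one_rpow]
  simp only [← mul_assoc, mul_inv_cancel₀ hc0.ne', one_mul, hcancel] at key
  have hδ : ((c ^ δ : ℝ) : ℂ) ≠ 0 := Complex.ofReal_ne_zero.mpr (Real.rpow_pos_of_pos hc0 δ).ne'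
  rw [key, Real.inv_rpow hc0.le, Complex.ofReal_inv, inv_mul_cancel_left₀ hδ]
end
end

section
/- Let X=(X_t)_{t∈𝕋} have infinitely divisible and weakly continuous finite-dimensional distributions, and suppose X is both (b,α,δ)-dilatively semistable and (c,α,δ)-dilatively semistable for parameters b,c>1 that are incommensurable in the sense that b^n ≠ c^m for all nonzero integers n,m (equivalently, log b / log c is irrational). Then X is (α,δ)-dilatively stable, i.e. D_X(α,δ) = (0,∞). -/
open MeasureTheory ProbabilityTheory Filter Topology

noncomputable section

theorem MemDilDecompGroup.mul {T : Set ℝ} {ψ : ∀ k : ℕ, (Fin k → ℝ) → (Fin k → ℝ) → ℂ}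
    {α δ x y : ℝ} (hT : ∀ a : ℝ, 0 < a → ∀ s ∈ T, a * s ∈ T)
    (hx : MemDilDecompGroup T ψ α δ x) (hy : MemDilDecompGroup T ψ α δ y) :
    MemDilDecompGroup T ψ α δ (x * y) := by
  obtain ⟨hx0, hx⟩ := hx
  obtain ⟨hy0, hy⟩ := hy
  refine ⟨mul_pos hx0 hy0, fun k t θ ht => ?_⟩
  have h := hx k (fun j => y * t j) θ fun j => hT y hy0 _ (ht j)
  rw [hy k t _ ht] at h
  simp only [mul_assoc, Real.mul_rpow hx0.le hy0.le] at h ⊢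
  rw [h]
  push_cast
  simp only [mul_assoc, mul_left_comm]

/-- The set of products `b ^ m * c ^ n` is dense in `(0, ∞)` if `b` and `c` are
incommensurable. -/
theorem exists_tendsto_zpow_mul_zpow {b c : ℝ} (hb : 1 < b) (hc : 1 < c)
    (hinc : ∀ n m : ℤ, n ≠ 0 → m ≠ 0 → b ^ n ≠ c ^ m) {a : ℝ} (ha : 0 < a) :
    ∃ m n : ℕ → ℤ, Tendsto (fun i => b ^ m i * c ^ n i) atTop (𝓝 a) := by
  have hb0 : 0 < b := by linarith
  have hc0 : 0 < c := by linarith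
  have hirr : Irrational (Real.log b / Real.log c) := by
    rintro ⟨q, hq⟩
    have hlb := Real.log_pos hb
    have hlc := Real.log_pos hc
    have hq0 : q ≠ 0 := by
      rintro rfl
      have := div_pos hlb hlc
      simp [← hq] at this
    refine hinc q.den q.num (by exact_mod_cast q.den_ne_zero) (Rat.num_ne_zero.2 hq0) ?_
    refine Real.log_injOn_pos (zpow_pos hb0 _) (zpow_pos hc0 _) ?_
    have hd : (q.den : ℝ) ≠ 0 := by exact_mod_cast q.den_ne_zero
    rw [Rat.cast_def] at hq
    field_simp at hq
    rw [Real.log_zpow, Real.log_zpow]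
    push_cast
    linarith
  obtain ⟨u, hu, hlim⟩ := mem_closure_iff_seq_limit.1
    ((dense_addSubgroupClosure_pair_iff.2 hirr) (Real.log a))
  choose m n hmn using fun i => AddSubgroup.mem_closure_pair.1 (hu i)
  refine ⟨m, n, ?_⟩
  have h := (Real.continuous_exp.tendsto _).comp hlim
  rw [Real.exp_log ha] at h
  refine h.congr fun i => ?_
  simp only [Function.comp_apply, ← hmn i, zsmul_eq_mul, Real.exp_add]
  rw [mul_comm (m i : ℝ), mul_comm (n i : ℝ), Real.exp_mul, Real.exp_mul, Real.exp_log hb0,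
    Real.exp_log hc0, Real.rpow_intCast, Real.rpow_intCast]

/-- Continuous complex functions agreeing at a point of a preconnected space are equal as soon as
their exponentials are. -/
theorem eq_of_exp_eq_exp {E : Type*} [TopologicalSpace E] [PreconnectedSpace E] {f g : E → ℂ}
    (hf : Continuous f) (hg : Continuous g) {x₀ : E} (h0 : f x₀ = g x₀)
    (h : ∀ x, Complex.exp (f x) = Complex.exp (g x)) : f = g :=
  Complex.isCoveringMap_exp.eq_of_comp_eq hf hg (funext fun x => Subtype.ext (h x)) x₀ h0

/-- Characteristic functions of weakly continuous families of laws depend continuously on the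
parameter. -/
theorem continuousOn_integral_exp {Ω : Type*} [MeasurableSpace Ω] (P : Measure Ω)
    [IsProbabilityMeasure P] {X : ℝ → Ω → ℝ} (hX : ∀ s, Measurable (X s)) {k : ℕ}
    {S : Set (Fin k → ℝ)}
    (hWC : ∀ g : BoundedContinuousFunction (Fin k → ℝ) ℝ,
      ContinuousOn (fun t : Fin k → ℝ => ∫ ω, g (fun j => X (t j) ω) ∂P) S)
    (θ : Fin k → ℝ) :
    ContinuousOn (fun t : Fin k → ℝ =>
      ∫ ω, Complex.exp (Complex.I * ((∑ j, θ j * X (t j) ω : ℝ) : ℂ)) ∂P) S := by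
  have hcos := hWC (BoundedContinuousFunction.ofNormedAddCommGroup
    (fun x => Real.cos (∑ j, θ j * x j)) (by fun_prop) 1 fun x => Real.abs_cos_le_one _)
  have hsin := hWC (BoundedContinuousFunction.ofNormedAddCommGroup
    (fun x => Real.sin (∑ j, θ j * x j)) (by fun_prop) 1 fun x => Real.abs_sin_le_one _)
  refine ((Complex.continuous_ofReal.comp_continuousOn hcos).add
    ((Complex.continuous_ofReal.comp_continuousOn hsin).mul continuousOn_const)).congr
    (f := fun t => _ + _ * Complex.I) fun t _ => ?_
  have hm : Measurable fun ω => ∑ j, θ j * X (t j) ω :=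
    Finset.measurable_sum _ fun j _ => (hX (t j)).const_mul _
  have hci : Integrable (fun ω => Real.cos (∑ j, θ j * X (t j) ω)) P :=
    Integrable.of_bound (Real.measurable_cos.comp hm).aestronglyMeasurable 1
      (ae_of_all _ fun ω => Real.abs_cos_le_one _)
  have hsi : Integrable (fun ω => Real.sin (∑ j, θ j * X (t j) ω)) P :=
    Integrable.of_bound (Real.measurable_sin.comp hm).aestronglyMeasurable 1
      (ae_of_all _ fun ω => Real.abs_sin_le_one _)
  simp only [Function.comp_apply, BoundedContinuousFunction.coe_ofNormedAddCommGroup]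
  rw [← integral_complex_ofReal, ← integral_complex_ofReal, ← integral_mul_const,
    ← integral_add hci.ofReal (hsi.ofReal.mul_const _)]
  refine integral_congr_ae (ae_of_all _ fun ω => ?_)
  simp only [mul_comm Complex.I, Complex.exp_mul_I, Complex.ofReal_cos, Complex.ofReal_sin]

/-- If `X` (with infinitely divisible, weakly continuous finite-dimensional
distributions) is both `(b,α,δ)`- and `(c,α,δ)`-dilatively semistable for
incommensurable `b, c > 1` (i.e. `b^n ≠ c^m` for all nonzero integers `n, m`), then `X`
is `(α,δ)`-dilatively stable, i.e. `D_X(α,δ) = (0,∞)`. -/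
theorem dilatively_semistable_incommensurable_implies_stable
    (T : Set ℝ) (hT : T = Set.univ ∨ T = Set.Ici 0 ∨ T = Set.Ioi 0)
    (Ω : Type*) [MeasurableSpace Ω] (P : Measure Ω) [IsProbabilityMeasure P]
    (X : ℝ → Ω → ℝ) (hXmeas : ∀ s : ℝ, Measurable (X s))
    (ψ : ∀ k : ℕ, (Fin k → ℝ) → (Fin k → ℝ) → ℂ)
    (hψ0 : ∀ (k : ℕ) (t : Fin k → ℝ), ψ k t 0 = 0)
    (hψcont : ∀ (k : ℕ) (t : Fin k → ℝ), Continuous (ψ k t))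
    (hchar : ∀ (k : ℕ) (t : Fin k → ℝ), (∀ j, t j ∈ T) → ∀ θ : Fin k → ℝ,
      Complex.exp (ψ k t θ) =
        ∫ ω, Complex.exp (Complex.I * ((∑ j, θ j * X (t j) ω : ℝ) : ℂ)) ∂P)
    (hID : ∀ (k : ℕ) (t : Fin k → ℝ), (∀ j, t j ∈ T) →
      InfinitelyDivisible (P.map fun ω j => X (t j) ω))
    -- weak continuity of the finite-dimensional distributions of `X`:
    (hWC : ∀ (k : ℕ) (g : BoundedContinuousFunction (Fin k → ℝ) ℝ),
      ContinuousOn (fun t : Fin k → ℝ => ∫ ω, g (fun j => X (t j) ω) ∂P)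
        {t : Fin k → ℝ | ∀ j, t j ∈ T})
    (α δ b c : ℝ) (hb1 : 1 < b) (hc1 : 1 < c)
    -- incommensurability: `b^n ≠ c^m` for all nonzero integers `n, m`
    (hinc : ∀ n m : ℤ, n ≠ 0 → m ≠ 0 → b ^ n ≠ c ^ m)
    -- `(b,α,δ)`-dilative semistability: `b^ℤ ⊆ D_X(α,δ)`
    (hsb : ∀ m : ℤ, MemDilDecompGroup T ψ α δ (b ^ m))
    -- `(c,α,δ)`-dilative semistability: `c^ℤ ⊆ D_X(α,δ)`
    (hsc : ∀ m : ℤ, MemDilDecompGroup T ψ α δ (c ^ m)) :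
    ∀ a : ℝ, 0 < a → MemDilDecompGroup T ψ α δ a := by
  have hTmul : ∀ a : ℝ, 0 < a → ∀ s ∈ T, a * s ∈ T := by
    intro a ha s hs
    rcases hT with rfl | rfl | rfl
    · trivial
    · exact mul_nonneg ha.le hs
    · exact mul_pos ha hs
  intro a ha
  obtain ⟨m, n, hlim⟩ := exists_tendsto_zpow_mul_zpow hb1 hc1 hinc ha
  set u : ℕ → ℝ := fun i => b ^ m i * c ^ n i
  have hu : ∀ i, MemDilDecompGroup T ψ α δ (u i) := fun i => (hsb _).mul hTmul (hsc _)
  refine ⟨ha, fun k t θ ht => ?_⟩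
  refine congrFun (eq_of_exp_eq_exp (g := fun θ => ((a ^ δ : ℝ) : ℂ) *
    ψ k t (fun j => a ^ (α - δ / 2) * θ j)) (hψcont k _)
    (continuous_const.mul ((hψcont k t).comp (by fun_prop))) (x₀ := 0) ?_ fun η => ?_) θ
  · have : (fun j => a ^ (α - δ / 2) * (0 : Fin k → ℝ) j) = 0 := by ext; simp
    simp only [this, hψ0, mul_zero]
  have hleft : Tendsto (fun i => Complex.exp (ψ k (fun j => u i * t j) η)) atTop
      (𝓝 (Complex.exp (ψ k (fun j => a * t j) η))) := by
    have hmem : ∀ x : ℝ, 0 < x → ∀ j, x * t j ∈ T := fun x hx j => hTmul x hx _ (ht j)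
    have hcont := continuousOn_integral_exp P hXmeas (hWC k) η (fun j => a * t j) (hmem a ha)
    rw [hchar k _ (hmem a ha) η]
    simp only [fun i => hchar k _ (hmem (u i) (hu i).1) η]
    refine hcont.tendsto.comp (tendsto_nhdsWithin_iff.2 ⟨?_, ?_⟩)
    · exact tendsto_pi_nhds.2 fun j => hlim.mul_const _
    · exact Eventually.of_forall fun i => hmem (u i) (hu i).1
  refine tendsto_nhds_unique hleft ?_
  simp only [fun i => (hu i).2 k t η ht]
  have hpow : ∀ r : ℝ, Tendsto (fun i => u i ^ r) atTop (𝓝 (a ^ r)) := fun r =>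
    hlim.rpow_const (Or.inl ha.ne')
  refine (Complex.continuous_exp.tendsto _).comp (Tendsto.mul ?_ ?_)
  · exact (Complex.continuous_ofReal.tendsto _).comp (hpow δ)
  · exact ((hψcont k t).tendsto _).comp
      (tendsto_pi_nhds.2 fun j => (hpow (α - δ / 2)).mul_const _)
end
end

section
/- Let X=(X_t)_{t≥0} have infinitely divisible finite-dimensional distributions with log-characteristic functions ψ satisfying: (i) time-homogeneity, ψ_{at_1,…,at_k}(θ_1,…,θ_k) = a·ψ_{t_1,…,t_k}(θ_1,…,θ_k) for all a>0 (as holds for a Lévy process), and (ii) semi-selfsimilarity with Hurst index 1/γ at scale c, ψ_{ct_1,…,ct_k}(θ_1,…,θ_k) = ψ_{t_1,…,t_k}(c^{1/γ}θ_1,…,c^{1/γ}θ_k), for some c>1 and γ∈(0,2). Then for every integer δ∈ℤ one has c ∈ D_X((1−δ)/γ + δ/2, δ); in particular X is (c, (1−δ)/γ + δ/2, δ)-dilatively semistable for every δ∈ℤ, so the parameters of dilative semistability are not uniquely determined. -/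
open MeasureTheory ProbabilityTheory Filter Topology

noncomputable section

/-- A function that is homogeneous under dilation by `b` with factor `c` is homogeneous under
dilation by `b ^ n` with factor `c ^ n`, for every integer `n`. -/
theorem dilation_zpow {ι : Type*} {f : (ι → ℝ) → ℂ} {b : ℝ} {c : ℂ} (hb : b ≠ 0) (hc : c ≠ 0)
    (h : ∀ θ : ι → ℝ, f (fun j => b * θ j) = c * f θ) (n : ℤ) (θ : ι → ℝ) :
    f (fun j => b ^ n * θ j) = c ^ n * f θ := by
  induction n with
  | zero => simp
  | succ n ih =>
    rw [zpow_add_one₀ hc, mul_right_comm, ← ih, mul_comm, ← h]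
    congr 1
    ext j
    rw [zpow_add_one₀ hb]
    ring
  | pred n ih =>
    apply mul_left_cancel₀ hc
    rw [← h, zpow_sub_one₀ hc, mul_comm _ c⁻¹, mul_assoc, mul_inv_cancel_left₀ hc, ← ih]
    congr 1
    ext j
    rw [zpow_sub_one₀ hb]
    field_simp

/-- For a process with time-homogeneous (as for a Lévy process) and semi-selfsimilar
(with Hurst index `1/γ` at scale `c`) log-characteristic functions, one has
`c ∈ D_X((1-δ)/γ + δ/2, δ)` for every integer `δ`; in particular `X` is
`(c, (1-δ)/γ + δ/2, δ)`-dilatively semistable for every `δ ∈ ℤ`, so the parameters of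
dilative semistability are not uniquely determined. -/
theorem semistable_levy_dilatively_semistable_all_delta
    (Ω : Type*) [MeasurableSpace Ω] (P : Measure Ω) [IsProbabilityMeasure P]
    (X : ℝ → Ω → ℝ) (hXmeas : ∀ s : ℝ, Measurable (X s))
    (ψ : ∀ k : ℕ, (Fin k → ℝ) → (Fin k → ℝ) → ℂ)
    (hψ0 : ∀ (k : ℕ) (t : Fin k → ℝ), ψ k t 0 = 0)
    (hψcont : ∀ (k : ℕ) (t : Fin k → ℝ), Continuous (ψ k t))
    (hchar : ∀ (k : ℕ) (t : Fin k → ℝ), (∀ j, t j ∈ Set.Ici (0:ℝ)) → ∀ θ : Fin k → ℝ,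
      Complex.exp (ψ k t θ) =
        ∫ ω, Complex.exp (Complex.I * ((∑ j, θ j * X (t j) ω : ℝ) : ℂ)) ∂P)
    (hID : ∀ (k : ℕ) (t : Fin k → ℝ), (∀ j, t j ∈ Set.Ici (0:ℝ)) →
      InfinitelyDivisible (P.map fun ω j => X (t j) ω))
    (c γ : ℝ) (hc : 1 < c) (hγ : γ ∈ Set.Ioo (0:ℝ) 2)
    -- (i) time-homogeneity: `ψ_{a t₁,…,a t_k}(θ) = a ψ_{t₁,…,t_k}(θ)` for all `a > 0`
    (hhom : ∀ a : ℝ, 0 < a → ∀ (k : ℕ) (t θ : Fin k → ℝ), (∀ j, 0 ≤ t j) →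
      ψ k (fun j => a * t j) θ = (a : ℂ) * ψ k t θ)
    -- (ii) semi-selfsimilarity with Hurst index `1/γ` at scale `c`
    (hss : ∀ (k : ℕ) (t θ : Fin k → ℝ), (∀ j, 0 ≤ t j) →
      ψ k (fun j => c * t j) θ = ψ k t (fun j => c ^ (1 / γ) * θ j)) :
    ∀ δ : ℤ,
      MemDilDecompGroup (Set.Ici 0) ψ ((1 - (δ:ℝ)) / γ + (δ:ℝ) / 2) (δ:ℝ) c ∧
      ∀ m : ℤ,
        MemDilDecompGroup (Set.Ici 0) ψ ((1 - (δ:ℝ)) / γ + (δ:ℝ) / 2) (δ:ℝ) (c ^ m) := by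
  intro δ
  have hc0 : 0 < c := one_pos.trans hc
  have hcC : (c : ℂ) ≠ 0 := by exact_mod_cast hc0.ne'
  have key (m : ℤ) :
      MemDilDecompGroup (Set.Ici 0) ψ ((1 - (δ:ℝ)) / γ + (δ:ℝ) / 2) (δ:ℝ) (c ^ m) := by
    refine ⟨zpow_pos hc0 m, fun k t θ ht => ?_⟩
    have hb : (c ^ m : ℝ) ^ ((1 - (δ:ℝ)) / γ + (δ:ℝ) / 2 - (δ:ℝ) / 2) =
        (c ^ (1 / γ)) ^ (m * (1 - δ)) := by
      rw [← Real.rpow_intCast, ← Real.rpow_intCast, ← Real.rpow_mul hc0.le,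
        ← Real.rpow_mul hc0.le]
      push_cast
      ring_nf
    have hdil : ∀ θ : Fin k → ℝ, ψ k t (fun j => c ^ (1 / γ) * θ j) = (c : ℂ) * ψ k t θ :=
      fun θ => by rw [← hss k t θ ht, hhom c hc0 k t θ ht]
    rw [hb, dilation_zpow (Real.rpow_pos_of_pos hc0 _).ne' hcC hdil,
      hhom _ (zpow_pos hc0 m) k t θ ht, ← mul_assoc, Real.rpow_intCast, ← zpow_mul]
    push_cast
    rw [← zpow_add₀ hcC]
    ring_nf
  exact ⟨by simpa using key 1, key⟩
end
end

section
/- Let φ:ℝ→ℂ be measurable, f:ℝ²→ℝ be measurable, and let c>1 and α,δ∈ℝ be such that the kernel scaling relation f(ct, c^δ u) = c^{α−δ/2} f(t,u) holds for all t,u∈ℝ. Assume that for every k∈ℕ, t_1,…,t_k∈ℝ and θ_1,…,θ_k∈ℝ the function u ↦ φ(∑_{j=1}^k θ_j f(t_j,u)) is Lebesgue integrable on ℝ, and define ψ_{t_1,…,t_k}(θ_1,…,θ_k) = −∫_ℝ φ(∑_{j=1}^k θ_j f(t_j,u)) du. Then for all k∈ℕ, t_1,…,t_k∈ℝ and θ_1,…,θ_k∈ℝ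 one has c^δ ψ_{t_1,…,t_k}(c^{α−δ/2}θ_1,…,c^{α−δ/2}θ_k) = ψ_{ct_1,…,ct_k}(θ_1,…,θ_k). (This is the scaling identity showing that a generalized fractional Lévy process with kernel f satisfying the above relation is (c,α,δ)-dilatively semistable.) -/
open MeasureTheory Filter Topology

noncomputable section

/-- If the kernel `f` of a generalized fractional Lévy process satisfies the scaling
relation `f(ct, c^δ u) = c^{α-δ/2} f(t,u)`, then the finite-dimensional
log-characteristic functions `ψ_{t₁,…,t_k}(θ) = -∫_ℝ φ(∑_j θ_j f(t_j,u)) du` satisfy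
`c^δ ψ_{t₁,…,t_k}(c^{α-δ/2}θ₁,…,c^{α-δ/2}θ_k) = ψ_{ct₁,…,ct_k}(θ₁,…,θ_k)`; i.e. the
process is `(c,α,δ)`-dilatively semistable. -/
theorem generalized_fractional_levy_dilatively_semistable
    (φ : ℝ → ℂ) (hφ : Measurable φ)
    (f : ℝ → ℝ → ℝ) (hf : Measurable (Function.uncurry f))
    (c α δ : ℝ) (hc : 1 < c)
    -- kernel scaling relation
    (hscale : ∀ t u : ℝ, f (c * t) (c ^ δ * u) = c ^ (α - δ / 2) * f t u)
    -- integrability of `u ↦ φ(∑_j θ_j f(t_j, u))` with respect to Lebesgue measure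
    (hint : ∀ (k : ℕ) (t θ : Fin k → ℝ),
      Integrable (fun u : ℝ => φ (∑ j, θ j * f (t j) u)))
    (ψ : ∀ k : ℕ, (Fin k → ℝ) → (Fin k → ℝ) → ℂ)
    (hψ : ∀ (k : ℕ) (t θ : Fin k → ℝ),
      ψ k t θ = -∫ u : ℝ, φ (∑ j, θ j * f (t j) u)) :
    ∀ (k : ℕ) (t θ : Fin k → ℝ),
      ((c ^ δ : ℝ) : ℂ) * ψ k t (fun j => c ^ (α - δ / 2) * θ j) =
        ψ k (fun j => c * t j) θ := by
  intro k t θ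
  have hpos : 0 < c ^ δ := Real.rpow_pos_of_pos (by linarith) δ
  have hchange := Measure.integral_comp_mul_left
    (fun u : ℝ => φ (∑ j, θ j * f (c * t j) u)) (c ^ δ)
  have hkernel : ∀ u : ℝ, ∑ j, θ j * f (c * t j) (c ^ δ * u) =
      ∑ j, c ^ (α - δ / 2) * θ j * f (t j) u := fun u =>
    Finset.sum_congr rfl fun j _ => by rw [hscale]; ring
  simp only [hkernel] at hchange
  rw [hψ, hψ, hchange, abs_of_pos (inv_pos.mpr hpos), mul_neg, ← Complex.real_smul, smul_smul,
    mul_inv_cancel₀ hpos.ne', one_smul]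
end
end

section
/- Let δ≤0 and α∈ℝ, let (a_n)_{n∈ℕ}⊂(0,∞) be regularly varying of index δ/2−α, and let (b_n)_{n∈ℕ}⊂ℕ be regularly varying of index −δ. Fix k∈ℕ, let ν_{t_1,…,t_k}:ℝ^k→ℂ (for t_1,…,t_k∈𝕋) be the characteristic functions of the finite-dimensional distributions of a process Y=(Y_t)_{t∈𝕋}, and let ψ_{t_1,…,t_k}:ℝ^k→ℂ be continuous functions of (t_1,…,t_k,θ_1,…,θ_k). Suppose that b_n·(ν_{nt_1,…,nt_k}(a_nθ_1,…,a_nθ_k) − 1) → ψ_{t_1,…,t_k}(θ_1,…,θ_k) as n→∞, uniformly on compact subsets of (t_1,…,t_k,θ_1,…,θ_k)∈𝕋^k×ℝ^k. Then for every T>0 and all t_1,…,t_k∈𝕋, θ_1,…,θ_k∈ℝ: ψ_{Tt_1,…,Tt_k}(θ_1,…,θ_k) = T^δ ψ_{t_1,…,t_k}(T^{α−δ/2}θ_1,…,T^{α−δ/2}θ_k). -/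
open MeasureTheory Filter Topology

noncomputable section

/-- A positive sequence `a` is regularly varying of index `γ` if
`a ⌊λ n⌋ / a n → λ^γ` for every `λ > 0`. -/
def RegularlyVarying (a : ℕ → ℝ) (γ : ℝ) : Prop :=
  ∀ lam : ℝ, 0 < lam →
    Tendsto (fun n : ℕ => a ⌊lam * (n : ℝ)⌋₊ / a n) atTop (nhds (lam ^ γ))

/-- A uniformly convergent family, evaluated along indices tending to infinity and points of the
set tending to `x`, tends to the value at `x` of the continuous limit. -/
theorem tendsto_comp_of_tendstoUniformlyOn {ι κ X E : Type*} [TopologicalSpace X] [UniformSpace E]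
    {l : Filter ι} {l' : Filter κ} {F : κ → X → E} {f : X → E} {K : Set X}
    (hF : TendstoUniformlyOn F f l' K) {x : X} (hf : ContinuousAt f x)
    {m : ι → κ} (hm : Tendsto m l l') {p : ι → X} (hp : Tendsto p l (𝓝 x))
    (hpK : ∀ᶠ i in l, p i ∈ K) :
    Tendsto (fun i => F (m i) (p i)) l (𝓝 (f x)) := by
  have hdiff := (tendstoUniformlyOn_iff_tendsto.mp hF).comp
    (hm.prodMk (tendsto_principal.mpr hpK))
  exact (Uniform.tendsto_congr hdiff).mp (hf.tendsto.comp hp)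

theorem RegularlyVarying.eventually_ne_zero {a : ℕ → ℝ} {γ : ℝ} (ha : RegularlyVarying a γ) :
    ∀ᶠ n in atTop, a n ≠ 0 := by
  have h := ha 1 one_pos
  rw [Real.one_rpow] at h
  filter_upwards [h.eventually_ne one_ne_zero] with n hn h0
  simp [h0] at hn

/-- If `δ ≤ 0`, `(aₙ) ∈ RV(δ/2-α)`, `(bₙ) ⊆ ℕ` with `(bₙ) ∈ RV(-δ)`, and
`bₙ (ν_{n t}(aₙ θ) - 1) → ψ_t(θ)` uniformly on compact subsets of `𝕋^k × ℝ^k`, where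
`ν` are the characteristic functions of the finite-dimensional distributions of a
process `Y` and `ψ` is jointly continuous, then `ψ` satisfies the dilative stability
scaling relation `ψ_{Tt}(θ) = T^δ ψ_t(T^{α-δ/2} θ)` for every `T > 0`. -/
theorem limit_aggregation_dilatively_stable_neg_delta
    (T : Set ℝ) (hT : T = Set.univ ∨ T = Set.Ici 0 ∨ T = Set.Ioi 0)
    (α δ : ℝ) (hδ : δ ≤ 0)
    (a : ℕ → ℝ) (hapos : ∀ n, 0 < a n) (haRV : RegularlyVarying a (δ / 2 - α))
    (b : ℕ → ℕ) (hbRV : RegularlyVarying (fun n => (b n : ℝ)) (-δ))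
    (k : ℕ)
    (Ω : Type*) [MeasurableSpace Ω] (P : Measure Ω) [IsProbabilityMeasure P]
    (Y : ℝ → Ω → ℝ)
    (ν : (Fin k → ℝ) → (Fin k → ℝ) → ℂ)
    (hν : ∀ t : Fin k → ℝ, (∀ j, t j ∈ T) → ∀ θ : Fin k → ℝ,
      ν t θ = ∫ ω, Complex.exp (Complex.I * ((∑ j, θ j * Y (t j) ω : ℝ) : ℂ)) ∂P)
    (ψ : (Fin k → ℝ) → (Fin k → ℝ) → ℂ)
    (hψcont : Continuous (fun p : (Fin k → ℝ) × (Fin k → ℝ) => ψ p.1 p.2))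
    (hconv : ∀ K : Set ((Fin k → ℝ) × (Fin k → ℝ)), IsCompact K →
      (∀ p ∈ K, ∀ j, p.1 j ∈ T) →
      TendstoUniformlyOn
        (fun (n : ℕ) (p : (Fin k → ℝ) × (Fin k → ℝ)) =>
          (b n : ℂ) * (ν (fun j => (n : ℝ) * p.1 j) (fun j => a n * p.2 j) - 1))
        (fun p => ψ p.1 p.2) atTop K) :
    ∀ C : ℝ, 0 < C → ∀ t θ : Fin k → ℝ, (∀ j, t j ∈ T) →
      ψ (fun j => C * t j) θ =
        ((C ^ δ : ℝ) : ℂ) * ψ t (fun j => C ^ (α - δ / 2) * θ j) := by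
  intro C hC t θ ht
  have hmulT : ∀ s : ℝ, 0 < s → ∀ j, s * t j ∈ T := by
    intro s hs j
    have hj := ht j
    rcases hT with rfl | rfl | rfl
    · trivial
    · exact mul_nonneg hs.le hj
    · exact mul_pos hs hj
  set c : ℝ := C ^ (α - δ / 2) with hc
  let m : ℕ → ℕ := fun n => ⌊C * (n : ℝ)⌋₊
  have hCn : Tendsto (fun n : ℕ => C * (n : ℝ)) atTop atTop :=
    tendsto_natCast_atTop_atTop.const_mul_atTop hC
  have hm : Tendsto m atTop atTop := tendsto_nat_floor_atTop.comp hCn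
  have hs : Tendsto (fun n : ℕ => C * (n : ℝ) / (m n : ℝ)) atTop (𝓝 1) := by
    have h := ((tendsto_nat_floor_div_atTop (R := ℝ)).comp hCn).inv₀ one_ne_zero
    simpa [m, Function.comp_def] using h
  have hr : Tendsto (fun n : ℕ => a n / a (m n)) atTop (𝓝 c) := by
    have h := (haRV C hC).inv₀ (Real.rpow_pos_of_pos hC _).ne'
    rw [← Real.rpow_neg hC.le, neg_sub] at h
    simpa [m] using h
  let g : ℝ × ℝ → (Fin k → ℝ) × (Fin k → ℝ) :=
    fun q => (fun j => q.1 * t j, fun j => q.2 * θ j)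
  have hg : Continuous g := by fun_prop
  let K := g '' (Set.Icc (1 / 2) 2 ×ˢ Set.Icc (c - 1) (c + 1))
  have hK : IsCompact K := (isCompact_Icc.prod isCompact_Icc).image hg
  have hKT : ∀ p ∈ K, ∀ j, p.1 j ∈ T := by
    rintro _ ⟨q, hq, rfl⟩
    exact hmulT q.1 (one_half_pos.trans_le hq.1.1)
  have hpK : ∀ᶠ n : ℕ in atTop, g (C * (n : ℝ) / (m n : ℝ), a n / a (m n)) ∈ K := by
    filter_upwards [hs.eventually_mem (Icc_mem_nhds (a := 1 / 2) (b := 2) (by norm_num)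
      (by norm_num)), hr.eventually_mem (Icc_mem_nhds (sub_one_lt c) (lt_add_one c))]
      with n h₁ h₂ using Set.mem_image_of_mem g ⟨h₁, h₂⟩
  have hfloor := tendsto_comp_of_tendstoUniformlyOn (hconv K hK hKT) hψcont.continuousAt hm
    (hg.continuousAt.tendsto.comp (hs.prodMk_nhds hr)) hpK
  have hscaled : Tendsto (fun n : ℕ => (b n : ℂ) *
      (ν (fun j => (n : ℝ) * (C * t j)) (fun j => a n * θ j) - 1)) atTop
      (𝓝 (ψ (fun j => C * t j) θ)) :=
    (hconv {(fun j => C * t j, θ)} isCompact_singleton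
      (by rintro _ rfl; exact hmulT C hC)).tendsto_at rfl
  have hratio : Tendsto (fun n : ℕ => (((b (m n) : ℝ) / (b n : ℝ) : ℝ) : ℂ)) atTop
      (𝓝 ((C ^ (-δ) : ℝ) : ℂ)) :=
    (Complex.continuous_ofReal.tendsto _).comp (hbRV C hC)
  have hlim : ψ t (fun j => c * θ j) = ((C ^ (-δ) : ℝ) : ℂ) * ψ (fun j => C * t j) θ := by
    have h := tendsto_nhds_unique_of_eventuallyEq hfloor (hratio.mul hscaled) (by
      filter_upwards [hm.eventually_gt_atTop 0, hbRV.eventually_ne_zero] with n hmn hbn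
      have hmn' : (m n : ℝ) ≠ 0 := by exact_mod_cast hmn.ne'
      have hbn' : (b n : ℂ) ≠ 0 := by exact_mod_cast hbn
      have ham := (hapos (m n)).ne'
      have h₁ : (fun j => (m n : ℝ) * (C * (n : ℝ) / (m n : ℝ) * t j)) =
          fun j => (n : ℝ) * (C * t j) := by
        funext j; field_simp
      have h₂ : (fun j => a (m n) * (a n / a (m n) * θ j)) = fun j => a n * θ j := by
        funext j; field_simp
      simp only [Function.comp_apply, g, h₁, h₂]
      push_cast
      field_simp)
    simpa [g] using h
  rw [hlim, ← mul_assoc, ← Complex.ofReal_mul, ← Real.rpow_add hC, add_neg_cancel, Real.rpow_zero,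
    Complex.ofReal_one, one_mul]
end
end

section
/- Let δ≥0 and α∈ℝ, let (a_n)_{n∈ℕ}⊂(0,∞) be regularly varying of index δ/2−α, and let (b_n)_{n∈ℕ}⊂ℕ be regularly varying of index δ. Fix k∈ℕ, let ν_{t_1,…,t_k}:ℝ^k→ℂ (for t_1,…,t_k∈𝕋) be the characteristic functions of the finite-dimensional distributions of a process Y=(Y_t)_{t∈𝕋}, and let ψ_{t_1,…,t_k}:ℝ^k→ℂ be continuous functions of (t_1,…,t_k,θ_1,…,θ_k). Suppose that b_n·(ν_{t_1/n,…,t_k/n}(a_n^{-1}θ_1,…,a_n^{-1}θ_k) − 1) → ψ_{t_1,…,t_k}(θ_1,…,θ_k) as n→∞, uniformly on compact subsets of (t_1,…,t_k,θ_1,…,θ_k)∈𝕋^k×ℝ^k. Then for every T>0 and all t_1,…,t_k∈𝕋, θ_1,…,θ_k∈ℝ: ψ_{Tt_1,…,Tt_k}(θ_1,…,θ_k) = T^δ ψ_{t_1,…,t_k}(T^{α−δ/2}θ_1,…,T^{α−δ/2}θ_k). -/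
open MeasureTheory Filter Topology

noncomputable section

/-- A uniformly convergent sequence of functions with continuous limit converges along
convergent sequences of points, after reindexing. -/
theorem TendstoUniformlyOn.tendsto_reindex {X E : Type*} [TopologicalSpace X]
    [SeminormedAddCommGroup E] {F : ℕ → X → E} {f : X → E} {K : Set X}
    (h : TendstoUniformlyOn F f atTop K) (hf : Continuous f) {m : ℕ → ℕ}
    (hm : Tendsto m atTop atTop) {p : ℕ → X} {x : X} (hp : Tendsto p atTop (𝓝 x))
    (hpK : ∀ᶠ n in atTop, p n ∈ K) :
    Tendsto (fun n => F (m n) (p n)) atTop (𝓝 (f x)) := by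
  have hlim : Tendsto (fun n => f (p n)) atTop (𝓝 (f x)) := (hf.tendsto x).comp hp
  refine hlim.congr_dist ?_
  rw [Metric.tendsto_nhds]
  intro ε hε
  filter_upwards [hm.eventually (Metric.tendstoUniformlyOn_iff.1 h ε hε), hpK] with n hn hnK
  simpa [Real.dist_eq, abs_of_nonneg dist_nonneg] using hn _ hnK

/-- If `δ ≥ 0`, `(aₙ) ∈ RV(δ/2-α)`, `(bₙ) ⊆ ℕ` with `(bₙ) ∈ RV(δ)`, and
`bₙ (ν_{t/n}(aₙ⁻¹ θ) - 1) → ψ_t(θ)` uniformly on compact subsets of `𝕋^k × ℝ^k`, where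
`ν` are the characteristic functions of the finite-dimensional distributions of a
process `Y` and `ψ` is jointly continuous, then `ψ` satisfies the dilative stability
scaling relation `ψ_{Tt}(θ) = T^δ ψ_t(T^{α-δ/2} θ)` for every `T > 0`. -/
theorem limit_aggregation_dilatively_stable_pos_delta
    (T : Set ℝ) (hT : T = Set.univ ∨ T = Set.Ici 0 ∨ T = Set.Ioi 0)
    (α δ : ℝ) (hδ : 0 ≤ δ)
    (a : ℕ → ℝ) (hapos : ∀ n, 0 < a n) (haRV : RegularlyVarying a (δ / 2 - α))
    (b : ℕ → ℕ) (hbRV : RegularlyVarying (fun n => (b n : ℝ)) δ)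
    (k : ℕ)
    (Ω : Type*) [MeasurableSpace Ω] (P : Measure Ω) [IsProbabilityMeasure P]
    (Y : ℝ → Ω → ℝ)
    (ν : (Fin k → ℝ) → (Fin k → ℝ) → ℂ)
    (hν : ∀ t : Fin k → ℝ, (∀ j, t j ∈ T) → ∀ θ : Fin k → ℝ,
      ν t θ = ∫ ω, Complex.exp (Complex.I * ((∑ j, θ j * Y (t j) ω : ℝ) : ℂ)) ∂P)
    (ψ : (Fin k → ℝ) → (Fin k → ℝ) → ℂ)
    (hψcont : Continuous (fun p : (Fin k → ℝ) × (Fin k → ℝ) => ψ p.1 p.2))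
    (hconv : ∀ K : Set ((Fin k → ℝ) × (Fin k → ℝ)), IsCompact K →
      (∀ p ∈ K, ∀ j, p.1 j ∈ T) →
      TendstoUniformlyOn
        (fun (n : ℕ) (p : (Fin k → ℝ) × (Fin k → ℝ)) =>
          (b n : ℂ) * (ν (fun j => p.1 j / (n : ℝ)) (fun j => (a n)⁻¹ * p.2 j) - 1))
        (fun p => ψ p.1 p.2) atTop K) :
    ∀ C : ℝ, 0 < C → ∀ t θ : Fin k → ℝ, (∀ j, t j ∈ T) →
      ψ (fun j => C * t j) θ =
        ((C ^ δ : ℝ) : ℂ) * ψ t (fun j => C ^ (α - δ / 2) * θ j) := by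
  intro C hC t θ ht
  have hTmul : ∀ s : ℝ, 0 < s → ∀ x ∈ T, s * x ∈ T := by
    intro s hs x hx
    rcases hT with rfl | rfl | rfl
    · trivial
    · exact mul_nonneg hs.le hx
    · exact mul_pos hs hx
  have hquot : Tendsto (fun n : ℕ => (⌊C * (n : ℝ)⌋₊ : ℝ) / n) atTop (𝓝 C) :=
    (tendsto_nat_floor_mul_div_atTop hC.le).comp tendsto_natCast_atTop_atTop
  have hfloor : Tendsto (fun n : ℕ => ⌊C * (n : ℝ)⌋₊) atTop atTop :=
    tendsto_nat_floor_atTop.comp (tendsto_natCast_atTop_atTop.const_mul_atTop hC)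
  have hratio : Tendsto (fun n : ℕ => a n / a ⌊C * (n : ℝ)⌋₊) atTop
      (𝓝 (C ^ (α - δ / 2))) := by
    have h := (haRV C hC).inv₀ (Real.rpow_pos_of_pos hC _).ne'
    rw [← Real.rpow_neg hC.le, neg_sub] at h
    simpa only [inv_div] using h
  have hbne : ∀ᶠ n in atTop, (b n : ℂ) ≠ 0 := by
    have h := hbRV 1 one_pos
    rw [Real.one_rpow] at h
    filter_upwards [h.eventually_ne one_ne_zero] with n hn hb
    exact hn (by simp [Nat.cast_eq_zero.1 hb])
  have hleft := by
    refine (hconv ((fun s : ℝ => ((fun j => s * t j), θ)) '' Set.Icc (C / 2) (2 * C))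
      (isCompact_Icc.image (by fun_prop)) ?_).tendsto_reindex hψcont hfloor
      (p := fun n : ℕ => ((fun j => (⌊C * (n : ℝ)⌋₊ : ℝ) / n * t j), θ))
      (x := ((fun j => C * t j), θ)) ?_ ?_
    · rintro _ ⟨s, hs, rfl⟩ j
      exact hTmul s ((half_pos hC).trans_le hs.1) _ (ht j)
    · exact (tendsto_pi_nhds.2 fun j => hquot.mul_const _).prodMk_nhds tendsto_const_nhds
    · filter_upwards [hquot.eventually (Icc_mem_nhds (half_lt_self hC)
        (lt_mul_of_one_lt_left hC one_lt_two))] with n hn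
      exact ⟨_, hn, rfl⟩
  have hright := by
    refine (hconv ((fun r : ℝ => (t, (fun j => r * θ j))) ''
      Set.Icc (C ^ (α - δ / 2) - 1) (C ^ (α - δ / 2) + 1))
      (isCompact_Icc.image (by fun_prop)) ?_).tendsto_reindex hψcont tendsto_id
      (p := fun n : ℕ => (t, (fun j => a n / a ⌊C * (n : ℝ)⌋₊ * θ j)))
      (x := (t, (fun j => C ^ (α - δ / 2) * θ j))) ?_ ?_
    · rintro _ ⟨r, -, rfl⟩ j
      exact ht j
    · exact tendsto_const_nhds.prodMk_nhds (tendsto_pi_nhds.2 fun j => hratio.mul_const _)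
    · filter_upwards [hratio.eventually (Icc_mem_nhds (sub_one_lt _) (lt_add_one _))] with n hn
      exact ⟨_, hn, rfl⟩
  have hb := (Complex.continuous_ofReal.tendsto _).comp (hbRV C hC)
  refine tendsto_nhds_unique hleft ((hb.mul hright).congr' ?_)
  filter_upwards [hbne, eventually_gt_atTop 0, hfloor.eventually_gt_atTop 0] with n hbn hn hm
  have hn' : (n : ℝ) ≠ 0 := Nat.cast_ne_zero.2 hn.ne'
  have hm' : (⌊C * (n : ℝ)⌋₊ : ℝ) ≠ 0 := Nat.cast_ne_zero.2 hm.ne'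
  have htime : (fun j => (⌊C * (n : ℝ)⌋₊ : ℝ) / n * t j / (⌊C * (n : ℝ)⌋₊ : ℝ)) =
      fun j => t j / (n : ℝ) := by
    ext j
    field_simp
  have hfreq : (fun j => (a n)⁻¹ * (a n / a ⌊C * (n : ℝ)⌋₊ * θ j)) =
      fun j => (a ⌊C * (n : ℝ)⌋₊)⁻¹ * θ j := by
    ext j
    have := (hapos n).ne'
    field_simp
  simp only [id_eq, Function.comp_apply, htime, hfreq]
  push_cast
  field_simp
end
end

section
/- Let δ≤0 and α∈ℝ, let (a_n)_{n∈ℕ}⊂(0,∞) be regularly varying of index δ/2−α, let (b_n)_{n∈ℕ}⊂ℕ be regularly varying of index −δ, and let (k(n))_{n∈ℕ}⊂ℕ satisfy k(n+1)/k(n) → c for some c>1. Fix k∈ℕ, let ν_{t_1,…,t_k}:ℝ^k→ℂ (for t_1,…,t_k∈𝕋) be the characteristic functions of the finite-dimensional distributions of a process Y=(Y_t)_{t∈𝕋}, and let ψ_{t_1,…,t_k}:ℝ^k→ℂ be continuous functions of (t_1,…,t_k,θ_1,…,θ_k). Suppose that b_{k(n)}·(ν_{k(n)t_1,…,k(n)t_k}(a_{k(n)}θ_1,…,a_{k(n)}θ_k)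 − 1) → ψ_{t_1,…,t_k}(θ_1,…,θ_k) as n→∞, uniformly on compact subsets of (t_1,…,t_k,θ_1,…,θ_k)∈𝕋^k×ℝ^k. Then for all t_1,…,t_k∈𝕋 and θ_1,…,θ_k∈ℝ: ψ_{ct_1,…,ct_k}(θ_1,…,θ_k) = c^δ ψ_{t_1,…,t_k}(c^{α−δ/2}θ_1,…,c^{α−δ/2}θ_k). -/
open MeasureTheory Filter Topology

noncomputable section

/-- If `g ⌊x n⌋ - g n → 0` for every `x > 0`, then the (truncated) convergence holds in mean over
every compact interval of positive reals. -/
theorem tendsto_integral_min_abs_sub_floor {g : ℕ → ℝ}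
    (hg : ∀ x : ℝ, 0 < x → Tendsto (fun n : ℕ => g ⌊x * (n : ℝ)⌋₊ - g n) atTop (𝓝 0))
    {p q : ℝ} (hp : 0 < p) (hpq : p ≤ q) :
    Tendsto (fun n : ℕ => ∫ x in p..q, min |g ⌊x * (n : ℝ)⌋₊ - g n| 1) atTop (𝓝 0) := by
  have h0 : (0 : ℝ) = ∫ _x in p..q, (0 : ℝ) := by simp
  rw [h0]
  apply intervalIntegral.tendsto_integral_filter_of_dominated_convergence (fun _ => (1 : ℝ))
  · refine Eventually.of_forall fun n => Measurable.aestronglyMeasurable ?_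
    have hm : Measurable fun x : ℝ => g ⌊x * (n : ℝ)⌋₊ :=
      (measurable_from_nat (f := g)).comp (Nat.measurable_floor.comp (measurable_id.mul_const _))
    fun_prop
  · refine Eventually.of_forall fun n => Eventually.of_forall fun x _ => ?_
    rw [Real.norm_of_nonneg (by positivity)]
    exact min_le_right _ _
  · simp
  · refine Eventually.of_forall fun x hx => ?_
    rw [Set.uIoc_of_le hpq] at hx
    simpa using (hg x (hp.trans hx.1)).abs.min (tendsto_const_nhds (x := (1 : ℝ)))

theorem intervalIntegrable_min_abs_sub_floor (g : ℕ → ℝ) (y z p q : ℝ) :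
    IntervalIntegrable (fun x : ℝ => min |g ⌊x * y⌋₊ - z| 1) volume p q := by
  have hm : Measurable fun x : ℝ => g ⌊x * y⌋₊ :=
    (measurable_from_nat (f := g)).comp (Nat.measurable_floor.comp (measurable_id.mul_const _))
  refine (intervalIntegrable_const (c := (1 : ℝ))).mono_fun' ?_ ?_
  · exact Measurable.aestronglyMeasurable (by fun_prop)
  · refine Eventually.of_forall fun x => ?_
    beta_reduce
    rw [Real.norm_of_nonneg (by positivity)]
    exact min_le_right _ _

/-- Uniform convergence theorem for slowly varying sequences, in additive form. -/
theorem tendsto_sub_of_tendsto_sub_floor {g : ℕ → ℝ}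
    (hg : ∀ x : ℝ, 0 < x → Tendsto (fun n : ℕ => g ⌊x * (n : ℝ)⌋₊ - g n) atTop (𝓝 0))
    {u v : ℕ → ℕ} (hu : Tendsto u atTop atTop) (hv : Tendsto v atTop atTop)
    {r : ℝ} (hr : 0 < r) (huv : Tendsto (fun j => (u j : ℝ) / (v j : ℝ)) atTop (𝓝 r)) :
    Tendsto (fun j => g (u j) - g (v j)) atTop (𝓝 0) := by
  have hmin : Tendsto (fun j => min |g (u j) - g (v j)| 1) atTop (𝓝 0) := by
    have hI := (tendsto_integral_min_abs_sub_floor hg one_pos one_le_two).comp hu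
    have hJ := ((tendsto_integral_min_abs_sub_floor hg (half_pos hr)
      (by linarith : r / 2 ≤ 3 * r)).comp hv).const_mul (r / 2)⁻¹
    have hsum := hI.add hJ
    rw [mul_zero, add_zero] at hsum
    refine squeeze_zero' (Eventually.of_forall fun j => by positivity) ?_ hsum
    filter_upwards [hv.eventually_gt_atTop 0,
      huv.eventually (Ioo_mem_nhds (by linarith : r / 2 < r) (by linarith : r < 3 / 2 * r))]
      with j hvj hρ
    set ρ : ℝ := (u j : ℝ) / (v j : ℝ) with hρdef
    have hρpos : 0 < ρ := (half_pos hr).trans hρ.1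
    have hv0 : (v j : ℝ) ≠ 0 := by positivity
    have hfloor : ∀ x : ℝ, x * (u j : ℝ) = x * (ρ * (v j : ℝ)) := fun x => by
      rw [hρdef, div_mul_cancel₀ _ hv0]
    have htri : ∀ x : ℝ, min |g (u j) - g (v j)| 1 ≤
        min |g ⌊x * (u j : ℝ)⌋₊ - g (u j)| 1 +
          min |g ⌊x * ρ * (v j : ℝ)⌋₊ - g (v j)| 1 := by
      intro x
      rw [mul_assoc, ← hfloor]
      set s := g ⌊x * (u j : ℝ)⌋₊
      have h1 : |g (u j) - g (v j)| ≤ |s - g (u j)| + |s - g (v j)| := by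
        rw [abs_sub_comm s (g (u j))]
        exact abs_sub_le _ _ _
      have h2 := abs_nonneg (s - g (u j))
      have h3 := abs_nonneg (s - g (v j))
      rcases le_total |s - g (u j)| 1 with h | h <;> rcases le_total |s - g (v j)| 1 with h' | h' <;>
        simp only [h, h', min_eq_left, min_eq_right] <;>
        first
        | exact (min_le_left _ _).trans h1
        | exact (min_le_right _ _).trans (by linarith)
    have hint2 : IntervalIntegrable
        (fun x : ℝ => min |g ⌊x * ρ * (v j : ℝ)⌋₊ - g (v j)| 1) volume 1 2 := by
      simpa only [mul_assoc] using intervalIntegrable_min_abs_sub_floor g (ρ * (v j : ℝ)) _ 1 2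
    have hint1 := intervalIntegrable_min_abs_sub_floor g (u j) (g (u j)) 1 2
    have hle := intervalIntegral.integral_mono_on (μ := volume) one_le_two
      (intervalIntegrable_const (c := min |g (u j) - g (v j)| 1))
      (hint1.add hint2) (fun x _ => htri x)
    rw [intervalIntegral.integral_const, intervalIntegral.integral_add hint1 hint2,
      intervalIntegral.integral_comp_mul_right
        (fun x : ℝ => min |g ⌊x * (v j : ℝ)⌋₊ - g (v j)| 1) hρpos.ne'] at hle
    have hmono : (∫ x in (1 * ρ)..(2 * ρ), min |g ⌊x * (v j : ℝ)⌋₊ - g (v j)| 1) ≤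
        ∫ x in (r / 2)..(3 * r), min |g ⌊x * (v j : ℝ)⌋₊ - g (v j)| 1 :=
      intervalIntegral.integral_mono_interval (by linarith [hρ.1]) (by linarith)
        (by linarith [hρ.2]) (Eventually.of_forall fun x => by positivity)
        (intervalIntegrable_min_abs_sub_floor g _ _ _ _)
    have hnonneg : 0 ≤ ∫ x in (1 * ρ)..(2 * ρ), min |g ⌊x * (v j : ℝ)⌋₊ - g (v j)| 1 :=
      intervalIntegral.integral_nonneg (by linarith) fun x _ => by positivity
    have hinv : ρ⁻¹ ≤ (r / 2)⁻¹ := inv_anti₀ (half_pos hr) hρ.1.le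
    have hprod := mul_le_mul hinv hmono hnonneg (by positivity)
    norm_num only [smul_eq_mul] at hle
    simp only [Function.comp_apply]
    linarith
  rw [tendsto_zero_iff_abs_tendsto_zero]
  refine hmin.congr' ?_
  filter_upwards [hmin.eventually (gt_mem_nhds one_pos)] with j hj
  rcases min_lt_iff.1 hj with h | h
  · exact min_eq_left h.le
  · exact absurd h (lt_irrefl _)

/-- The convergence defining regular variation is locally uniform: it holds along any two index
sequences tending to infinity whose ratio converges to a positive limit. -/
theorem RegularlyVarying.tendsto_div {a : ℕ → ℝ} {γ : ℝ} (ha : RegularlyVarying a γ)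
    (hpos : ∀ᶠ n in atTop, 0 < a n)
    {u v : ℕ → ℕ} (hu : Tendsto u atTop atTop) (hv : Tendsto v atTop atTop)
    {r : ℝ} (hr : 0 < r) (huv : Tendsto (fun j => (u j : ℝ) / (v j : ℝ)) atTop (𝓝 r)) :
    Tendsto (fun j => a (u j) / a (v j)) atTop (𝓝 (r ^ γ)) := by
  have hlog : ∀ {i j : ℕ}, 0 < a i → 0 < a j → 0 < i → 0 < j →
      Real.log (a i / a j) - γ * Real.log ((i : ℝ) / (j : ℝ)) =
        (Real.log (a i) - γ * Real.log i) - (Real.log (a j) - γ * Real.log j) := by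
    intro i j hai haj hi hj
    rw [Real.log_div hai.ne' haj.ne', Real.log_div (by positivity) (by positivity)]
    ring
  have hg : ∀ x : ℝ, 0 < x → Tendsto (fun n : ℕ =>
      (Real.log (a ⌊x * (n : ℝ)⌋₊) - γ * Real.log (⌊x * (n : ℝ)⌋₊ : ℕ)) -
        (Real.log (a n) - γ * Real.log n)) atTop (𝓝 0) := by
    intro x hx
    have hfl : Tendsto (fun n : ℕ => ⌊x * (n : ℝ)⌋₊) atTop atTop :=
      tendsto_nat_floor_atTop.comp (tendsto_natCast_atTop_atTop.const_mul_atTop hx)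
    have hratio : Tendsto (fun n : ℕ => (⌊x * (n : ℝ)⌋₊ : ℝ) / (n : ℝ)) atTop (𝓝 x) :=
      (tendsto_nat_floor_mul_div_atTop hx.le).comp tendsto_natCast_atTop_atTop
    have hlim := ((ha x hx).log (Real.rpow_pos_of_pos hx γ).ne').sub
      ((hratio.log hx.ne').const_mul γ)
    rw [Real.log_rpow hx, sub_self] at hlim
    refine hlim.congr' ?_
    filter_upwards [hpos, hfl.eventually hpos, eventually_gt_atTop 0, hfl.eventually_gt_atTop 0]
      with n h1 h2 h3 h4
    exact hlog h2 h1 h4 h3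
  have hmain := (tendsto_sub_of_tendsto_sub_floor
    (g := fun n => Real.log (a n) - γ * Real.log n) hg hu hv hr huv).add
    ((huv.log hr.ne').const_mul γ)
  have hexp := (Real.continuous_exp.tendsto _).comp hmain
  rw [zero_add, mul_comm γ, ← Real.rpow_def_of_pos hr] at hexp
  refine hexp.congr' ?_
  filter_upwards [hu.eventually hpos, hv.eventually hpos, hu.eventually_gt_atTop 0,
    hv.eventually_gt_atTop 0] with j h1 h2 h3 h4
  simp only [Function.comp_apply]
  rw [← hlog h1 h2 h3 h4, sub_add_cancel, Real.exp_log (div_pos h1 h2)]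

/-- A sequence of naturals whose successive ratios converge to a limit `> 1` tends to infinity. -/
theorem tendsto_atTop_of_tendsto_succ_div {u : ℕ → ℕ} {c : ℝ} (hc : 1 < c)
    (hu : Tendsto (fun n : ℕ => (u (n + 1) : ℝ) / (u n : ℝ)) atTop (𝓝 c)) :
    Tendsto u atTop atTop := by
  obtain ⟨N, hN⟩ := eventually_atTop.1 (hu.eventually (lt_mem_nhds hc))
  have hmono : StrictMono fun n => u (n + N) := by
    refine strictMono_nat_of_lt_succ fun n => ?_
    have h := hN (n + N) (Nat.le_add_left _ _)
    have h0 : (0 : ℝ) < u (n + N) := by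
      rcases Nat.eq_zero_or_pos (u (n + N)) with h' | h'
      · rw [h'] at h
        norm_num at h
      · exact_mod_cast h'
    rw [one_lt_div h0] at h
    have h' : u (n + N) < u (n + N + 1) := by exact_mod_cast h
    rwa [Nat.add_right_comm] at h'
  exact (tendsto_add_atTop_iff_nat N).1 hmono.tendsto_atTop

/-- If `δ ≤ 0`, `(aₙ) ∈ RV(δ/2-α)`, `(bₙ) ⊆ ℕ` with `(bₙ) ∈ RV(-δ)`,
`(k(n)) ⊆ ℕ` with `k(n+1)/k(n) → c > 1`, and
`b_{k(n)} (ν_{k(n) t}(a_{k(n)} θ) - 1) → ψ_t(θ)` uniformly on compact subsets of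
`𝕋^k × ℝ^k`, where `ν` are the characteristic functions of the finite-dimensional
distributions of a process `Y` and `ψ` is jointly continuous, then `ψ` satisfies the
dilative semistability scaling relation `ψ_{ct}(θ) = c^δ ψ_t(c^{α-δ/2} θ)`. -/
theorem limit_aggregation_dilatively_semistable_neg_delta
    (T : Set ℝ) (hT : T = Set.univ ∨ T = Set.Ici 0 ∨ T = Set.Ioi 0)
    (α δ : ℝ) (hδ : δ ≤ 0)
    (a : ℕ → ℝ) (hapos : ∀ n, 0 < a n) (haRV : RegularlyVarying a (δ / 2 - α))
    (b : ℕ → ℕ) (hbRV : RegularlyVarying (fun n => (b n : ℝ)) (-δ))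
    (kseq : ℕ → ℕ) (c : ℝ) (hc : 1 < c)
    (hk : Tendsto (fun n : ℕ => (kseq (n + 1) : ℝ) / (kseq n : ℝ)) atTop (nhds c))
    (k : ℕ)
    (Ω : Type*) [MeasurableSpace Ω] (P : Measure Ω) [IsProbabilityMeasure P]
    (Y : ℝ → Ω → ℝ)
    (ν : (Fin k → ℝ) → (Fin k → ℝ) → ℂ)
    (hν : ∀ t : Fin k → ℝ, (∀ j, t j ∈ T) → ∀ θ : Fin k → ℝ,
      ν t θ = ∫ ω, Complex.exp (Complex.I * ((∑ j, θ j * Y (t j) ω : ℝ) : ℂ)) ∂P)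
    (ψ : (Fin k → ℝ) → (Fin k → ℝ) → ℂ)
    (hψcont : Continuous (fun p : (Fin k → ℝ) × (Fin k → ℝ) => ψ p.1 p.2))
    (hconv : ∀ K : Set ((Fin k → ℝ) × (Fin k → ℝ)), IsCompact K →
      (∀ p ∈ K, ∀ j, p.1 j ∈ T) →
      TendstoUniformlyOn
        (fun (n : ℕ) (p : (Fin k → ℝ) × (Fin k → ℝ)) =>
          (b (kseq n) : ℂ) *
            (ν (fun j => (kseq n : ℝ) * p.1 j) (fun j => a (kseq n) * p.2 j) - 1))
        (fun p => ψ p.1 p.2) atTop K) :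
    ∀ t θ : Fin k → ℝ, (∀ j, t j ∈ T) →
      ψ (fun j => c * t j) θ =
        ((c ^ δ : ℝ) : ℂ) * ψ t (fun j => c ^ (α - δ / 2) * θ j) := by
  intro t θ ht
  have hc0 : 0 < c := one_pos.trans hc
  have hTmul : ∀ s : ℝ, 0 < s → ∀ x ∈ T, s * x ∈ T := by
    intro s hs x hx
    rcases hT with rfl | rfl | rfl
    · trivial
    · exact mul_nonneg hs.le hx
    · exact mul_pos hs hx
  have hkT : Tendsto kseq atTop atTop := tendsto_atTop_of_tendsto_succ_div hc hk
  have hkT' : Tendsto (fun n => kseq (n + 1)) atTop atTop := (tendsto_add_atTop_iff_nat 1).2 hkT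
  have haR := haRV.tendsto_div (Eventually.of_forall hapos) hkT' hkT hc0 hk
  have hb0 : ∀ᶠ n in atTop, (0 : ℝ) < b n :=
    hbRV.eventually_ne_zero.mono fun n hn => lt_of_le_of_ne (Nat.cast_nonneg _) hn.symm
  have hbR := hbRV.tendsto_div hb0 hkT' hkT hc0 hk
  set φ : Fin k → ℝ := fun j => c ^ (α - δ / 2) * θ j with hφ
  have hleft : Tendsto (fun n : ℕ => (b (kseq (n + 1)) : ℂ) *
      (ν (fun j => (kseq (n + 1) : ℝ) * t j) (fun j => a (kseq (n + 1)) * φ j) - 1))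
      atTop (𝓝 (ψ t φ)) := by
    have h := (hconv {(t, φ)} isCompact_singleton (by simpa using ht)).tendsto_at
      (Set.mem_singleton _)
    exact (tendsto_add_atTop_iff_nat 1).2 h
  -- truncating the ratios at `1` keeps every time point in `T`
  let x : ℕ → (Fin k → ℝ) × (Fin k → ℝ) := fun n =>
    (fun j => max ((kseq (n + 1) : ℝ) / (kseq n : ℝ)) 1 * t j,
      fun j => a (kseq (n + 1)) / a (kseq n) * φ j)
  have hx : Tendsto x atTop (𝓝 (fun j => c * t j, θ)) := by
    refine Tendsto.prodMk_nhds (tendsto_pi_nhds.2 fun j => ?_) (tendsto_pi_nhds.2 fun j => ?_)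
    · have h := (hk.max (tendsto_const_nhds (x := (1 : ℝ)))).mul_const (t j)
      rwa [max_eq_left hc.le] at h
    · have h := haR.mul_const (φ j)
      have hθ : c ^ (δ / 2 - α) * φ j = θ j := by
        rw [hφ, ← mul_assoc, ← Real.rpow_add hc0]
        simp
      rwa [hθ] at h
  have hunif := hconv _ hx.isCompact_insert_range (by
    rintro p (rfl | ⟨n, rfl⟩) j
    · exact hTmul c hc0 _ (ht j)
    · exact hTmul _ (lt_max_of_lt_right one_pos) _ (ht j))
  have hright := hunif.tendsto_comp hψcont.continuousWithinAt
    (tendsto_nhdsWithin_iff.2 ⟨hx, Eventually.of_forall fun n => Or.inr ⟨n, rfl⟩⟩)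
  have hbC : Tendsto (fun n => (((b (kseq (n + 1)) : ℝ) / (b (kseq n) : ℝ) : ℝ) : ℂ)) atTop
      (𝓝 ((c ^ (-δ) : ℝ) : ℂ)) := (Complex.continuous_ofReal.tendsto _).comp hbR
  have hprod := hbC.mul hright
  have heq : ψ t φ = ((c ^ (-δ) : ℝ) : ℂ) * ψ (fun j => c * t j) θ := by
    refine tendsto_nhds_unique hleft (hprod.congr' ?_)
    filter_upwards [hkT.eventually_gt_atTop 0, hkT.eventually hb0,
      hk.eventually (lt_mem_nhds hc)] with n hn hbn hrn
    have hkn : (kseq n : ℝ) ≠ 0 := by positivity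
    have hbn' : (b (kseq n) : ℂ) ≠ 0 := by exact_mod_cast hbn.ne'
    have h1 : (fun j => (kseq n : ℝ) * (x n).1 j) = fun j => (kseq (n + 1) : ℝ) * t j := by
      funext j
      simp only [x]
      rw [max_eq_left hrn.le, ← mul_assoc, mul_div_cancel₀ _ hkn]
    have h2 : (fun j => a (kseq n) * (x n).2 j) = fun j => a (kseq (n + 1)) * φ j := by
      funext j
      simp only [x]
      rw [← mul_assoc, mul_div_cancel₀ _ (hapos _).ne']
    rw [h1, h2]
    push_cast
    rw [← mul_assoc, div_mul_cancel₀ _ hbn']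
  rw [heq, ← mul_assoc, ← Complex.ofReal_mul, ← Real.rpow_add hc0, add_neg_cancel, Real.rpow_zero,
    Complex.ofReal_one, one_mul]
end
end

section
/- Let δ≥0 and α∈ℝ, let (a_n)_{n∈ℕ}⊂(0,∞) be regularly varying of index δ/2−α, let (b_n)_{n∈ℕ}⊂ℕ be regularly varying of index δ, and let (k(n))_{n∈ℕ}⊂ℕ satisfy k(n+1)/k(n) → c for some c>1. Fix k∈ℕ, let ν_{t_1,…,t_k}:ℝ^k→ℂ (for t_1,…,t_k∈𝕋) be the characteristic functions of the finite-dimensional distributions of a process Y=(Y_t)_{t∈𝕋}, and let ψ_{t_1,…,t_k}:ℝ^k→ℂ be continuous functions of (t_1,…,t_k,θ_1,…,θ_k). Suppose that b_{k(n)}·(ν_{t_1/k(n),…,t_k/k(n)}(a_{k(n)}^{-1}θ_1,…,a_{k(n)}^{-1}θ_k) − 1) → ψ_{t_1,…,t_k}(θ_1,…,θ_k) as n→∞, uniformly on compact subsets of (t_1,…,t_k,θ_1,…,θ_k)∈𝕋^k×ℝ^k. Then for all t_1,…,t_k∈𝕋 and θ_1,…,θ_k∈ℝ: ψ_{ct_1,…,ct_k}(θ_1,…,θ_k)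 = c^δ ψ_{t_1,…,t_k}(c^{α−δ/2}θ_1,…,c^{α−δ/2}θ_k). -/
open MeasureTheory Filter Topology

noncomputable section

/-- A function of the form `x ↦ ⌊eˣ n⌋` is locally constant to the right, so a bound on
`g ⌊eˣ n⌋` which holds on a set also holds on the interior of its closure. -/
theorem interior_closure_floor_exp_subset (g : ℕ → ℝ) (ε : ℝ) (N : ℕ) :
    interior (closure {x : ℝ | ∀ n ≥ N, |g ⌊Real.exp x * (n : ℝ)⌋₊ - g n| ≤ ε}) ⊆
      {x : ℝ | ∀ n ≥ N, |g ⌊Real.exp x * (n : ℝ)⌋₊ - g n| ≤ ε} := by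
  intro x hx n hn
  set E := {x : ℝ | ∀ n ≥ N, |g ⌊Real.exp x * (n : ℝ)⌋₊ - g n| ≤ ε}
  have hfloor : ∀ᶠ y in 𝓝 x, Real.exp y * (n : ℝ) < ⌊Real.exp x * (n : ℝ)⌋₊ + 1 :=
    (by fun_prop : Continuous fun y : ℝ => Real.exp y * (n : ℝ)).continuousAt.eventually_lt
      continuousAt_const (Nat.lt_floor_add_one _)
  have hmem : ∀ᶠ y in 𝓝 x, y ∈ interior (closure E) := isOpen_interior.mem_nhds hx
  obtain ⟨V, hV, hVo, hxV⟩ := eventually_nhds_iff.mp (hfloor.and hmem)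
  obtain ⟨z, hzV, hxz⟩ : ∃ z, z ∈ V ∧ x < z :=
    ((eventually_nhdsWithin_of_eventually_nhds (s := Set.Ioi x) (hVo.mem_nhds hxV)).and
      self_mem_nhdsWithin).exists
  obtain ⟨y, ⟨hyV, hxy⟩, hyE⟩ := mem_closure_iff.mp (interior_subset (hV z hzV).2)
    (V ∩ Set.Ioi x) (hVo.inter isOpen_Ioi) ⟨hzV, hxz⟩
  have hlt := (hV y hyV).1
  have hle : Real.exp x * (n : ℝ) ≤ Real.exp y * n := by
    gcongr
    exact (Set.mem_Ioi.mp hxy).le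
  have heq : ⌊Real.exp y * (n : ℝ)⌋₊ = ⌊Real.exp x * (n : ℝ)⌋₊ := by
    rw [Nat.floor_eq_iff (by positivity)]
    exact ⟨(Nat.floor_le (by positivity)).trans hle, hlt⟩
  rw [← heq]
  exact hyE n hn

/-- The uniform convergence theorem for additively slowly varying sequences, in sequential form. -/
theorem tendsto_sub_of_slowlyVarying (g : ℕ → ℝ)
    (hg : ∀ lam : ℝ, 0 < lam → Tendsto (fun n : ℕ => g ⌊lam * (n : ℝ)⌋₊ - g n) atTop (𝓝 0))
    {p m : ℕ → ℕ} (hp : Tendsto p atTop atTop) (hm : Tendsto m atTop atTop) {c : ℝ} (hc : 0 < c)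
    (hmp : Tendsto (fun n => (m n : ℝ) / (p n : ℝ)) atTop (𝓝 c)) :
    Tendsto (fun n => g (m n) - g (p n)) atTop (𝓝 0) := by
  rw [Metric.tendsto_atTop']
  suffices H : ∀ ε > 0, ∀ᶠ n in atTop, |g (m n) - g (p n)| < ε by
    intro ε hε
    obtain ⟨N, hN⟩ := eventually_atTop.mp (H ε hε)
    exact ⟨N, fun n hn => by simpa using hN n hn.le⟩
  intro ε hε
  let E : ℕ → Set ℝ := fun N => {x : ℝ | ∀ n ≥ N, |g ⌊Real.exp x * (n : ℝ)⌋₊ - g n| ≤ ε / 2}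
  have hcover : ⋃ N, closure (E N) = Set.univ := by
    refine Set.eq_univ_of_forall fun x => Set.mem_iUnion.mpr ?_
    obtain ⟨N, hN⟩ := eventually_atTop.mp
      ((hg _ (Real.exp_pos x)).abs.eventually_le_const
        (show |(0 : ℝ)| < ε / 2 by simpa using hε))
    exact ⟨N, subset_closure hN⟩
  obtain ⟨N, u, hu⟩ := nonempty_interior_of_iUnion_of_closed (fun _ => isClosed_closure) hcover
  have hlam : 0 < c * Real.exp u := by positivity
  have hp' : Tendsto (fun n => (p n : ℝ)) atTop atTop := tendsto_natCast_atTop_atTop.comp hp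
  have hpm : Tendsto (fun n => (⌊c * Real.exp u * (p n : ℝ)⌋₊ : ℝ) / (m n : ℝ)) atTop
      (𝓝 (Real.exp u)) := by
    have h := ((tendsto_nat_floor_mul_div_atTop hlam.le).comp hp').div hmp hc.ne'
    rw [mul_div_cancel_left₀ _ hc.ne'] at h
    refine h.congr' ?_
    filter_upwards [hp.eventually_gt_atTop 0] with n hn
    have : (p n : ℝ) ≠ 0 := by positivity
    simp only [Function.comp_apply, Pi.div_apply]
    field_simp
  have hlog := hpm.log (Real.exp_pos u).ne'
  rw [Real.log_exp] at hlog
  have h₁ := ((hg _ hlam).comp hp).abs.eventually_lt_const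
    (show |(0 : ℝ)| < ε / 2 by simpa using hε)
  filter_upwards [h₁, hlog.eventually (isOpen_interior.mem_nhds hu), hm.eventually_ge_atTop N,
    hm.eventually_gt_atTop 0, hpm.eventually_const_lt (Real.exp_pos u)] with n hn₁ hn₂ hn₃ hn₄ hn₅
  have h₂ := interior_closure_floor_exp_subset g (ε / 2) N hn₂ (m n) hn₃
  have hm0 : (m n : ℝ) ≠ 0 := by positivity
  rw [Real.exp_log hn₅, div_mul_cancel₀ _ hm0, Nat.floor_natCast] at h₂
  simp only [Function.comp_apply] at hn₁
  rw [abs_lt] at hn₁ ⊢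
  rw [abs_le] at h₂
  constructor <;> linarith

/-- The uniform convergence theorem for regularly varying sequences, in sequential form. -/
theorem RegularlyVarying.tendsto_div_s13 {a : ℕ → ℝ} {γ : ℝ} (ha : RegularlyVarying a γ)
    (hpos : ∀ᶠ n in atTop, 0 < a n) {p m : ℕ → ℕ} (hp : Tendsto p atTop atTop)
    (hm : Tendsto m atTop atTop) {c : ℝ} (hc : 0 < c)
    (hmp : Tendsto (fun n => (m n : ℝ) / (p n : ℝ)) atTop (𝓝 c)) :
    Tendsto (fun n => a (m n) / a (p n)) atTop (𝓝 (c ^ γ)) := by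
  let g : ℕ → ℝ := fun n => Real.log (a n) - γ * Real.log n
  have hsub : ∀ i j : ℕ, 0 < a i → 0 < a j → 0 < i → 0 < j →
      g i - g j = Real.log (a i / a j) - γ * Real.log ((i : ℝ) / j) := by
    intro i j hi hj hi0 hj0
    rw [Real.log_div hi.ne' hj.ne', Real.log_div (by positivity) (by positivity)]
    ring
  have hg : ∀ lam : ℝ, 0 < lam →
      Tendsto (fun n : ℕ => g ⌊lam * (n : ℝ)⌋₊ - g n) atTop (𝓝 0) := by
    intro lam hlam
    have hfl : Tendsto (fun n : ℕ => ⌊lam * (n : ℝ)⌋₊) atTop atTop :=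
      tendsto_nat_floor_atTop.comp (tendsto_natCast_atTop_atTop.const_mul_atTop hlam)
    have h := ((ha lam hlam).log (Real.rpow_pos_of_pos hlam γ).ne').sub
      ((((tendsto_nat_floor_mul_div_atTop hlam.le).comp
        tendsto_natCast_atTop_atTop).log hlam.ne').const_mul γ)
    rw [Real.log_rpow hlam, sub_self] at h
    refine h.congr' ?_
    filter_upwards [hpos, hfl.eventually hpos, eventually_gt_atTop 0, hfl.eventually_gt_atTop 0]
      with n h₁ h₂ h₃ h₄
    exact (hsub _ _ h₂ h₁ h₄ h₃).symm
  have h := (tendsto_sub_of_slowlyVarying g hg hp hm hc hmp).add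
    ((hmp.log hc.ne').const_mul γ)
  rw [zero_add, mul_comm] at h
  have h' := (Real.continuous_exp.tendsto _).comp h
  rw [← Real.rpow_def_of_pos hc] at h'
  refine h'.congr' ?_
  filter_upwards [hp.eventually hpos, hm.eventually hpos, hp.eventually_gt_atTop 0,
    hm.eventually_gt_atTop 0] with n h₁ h₂ h₃ h₄
  simp only [Function.comp_apply]
  rw [hsub _ _ h₂ h₁ h₄ h₃, sub_add_cancel, Real.exp_log (by positivity)]

/-- Natural numbers whose consecutive ratios converge to a limit `c > 1` tend to infinity. -/
theorem tendsto_atTop_of_tendsto_ratio {m : ℕ → ℕ} {c : ℝ} (hc : 1 < c)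
    (hm : Tendsto (fun n : ℕ => (m (n + 1) : ℝ) / (m n : ℝ)) atTop (𝓝 c)) :
    Tendsto m atTop atTop := by
  obtain ⟨N, hN⟩ := eventually_atTop.mp (hm.eventually_const_lt hc)
  rw [← tendsto_add_atTop_iff_nat N]
  refine StrictMono.tendsto_atTop (strictMono_nat_of_lt_succ fun n => ?_)
  have h := hN (n + N) (by omega)
  have h0 : (0 : ℝ) < m (n + N) := by
    refine lt_of_le_of_ne (Nat.cast_nonneg _) fun h0 => ?_
    rw [← h0, div_zero] at h
    linarith
  rw [one_lt_div h0] at h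
  rw [show n + 1 + N = n + N + 1 by omega]
  exact_mod_cast h

/-- If `δ ≥ 0`, `(aₙ) ∈ RV(δ/2-α)`, `(bₙ) ⊆ ℕ` with `(bₙ) ∈ RV(δ)`,
`(k(n)) ⊆ ℕ` with `k(n+1)/k(n) → c > 1`, and
`b_{k(n)} (ν_{t/k(n)}(a_{k(n)}⁻¹ θ) - 1) → ψ_t(θ)` uniformly on compact subsets of
`𝕋^k × ℝ^k`, where `ν` are the characteristic functions of the finite-dimensional
distributions of a process `Y` and `ψ` is jointly continuous, then `ψ` satisfies the
dilative semistability scaling relation `ψ_{ct}(θ) = c^δ ψ_t(c^{α-δ/2} θ)`. -/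
theorem limit_aggregation_dilatively_semistable_pos_delta
    (T : Set ℝ) (hT : T = Set.univ ∨ T = Set.Ici 0 ∨ T = Set.Ioi 0)
    (α δ : ℝ) (hδ : 0 ≤ δ)
    (a : ℕ → ℝ) (hapos : ∀ n, 0 < a n) (haRV : RegularlyVarying a (δ / 2 - α))
    (b : ℕ → ℕ) (hbRV : RegularlyVarying (fun n => (b n : ℝ)) δ)
    (kseq : ℕ → ℕ) (c : ℝ) (hc : 1 < c)
    (hk : Tendsto (fun n : ℕ => (kseq (n + 1) : ℝ) / (kseq n : ℝ)) atTop (nhds c))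
    (k : ℕ)
    (Ω : Type*) [MeasurableSpace Ω] (P : Measure Ω) [IsProbabilityMeasure P]
    (Y : ℝ → Ω → ℝ)
    (ν : (Fin k → ℝ) → (Fin k → ℝ) → ℂ)
    (hν : ∀ t : Fin k → ℝ, (∀ j, t j ∈ T) → ∀ θ : Fin k → ℝ,
      ν t θ = ∫ ω, Complex.exp (Complex.I * ((∑ j, θ j * Y (t j) ω : ℝ) : ℂ)) ∂P)
    (ψ : (Fin k → ℝ) → (Fin k → ℝ) → ℂ)
    (hψcont : Continuous (fun p : (Fin k → ℝ) × (Fin k → ℝ) => ψ p.1 p.2))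
    (hconv : ∀ K : Set ((Fin k → ℝ) × (Fin k → ℝ)), IsCompact K →
      (∀ p ∈ K, ∀ j, p.1 j ∈ T) →
      TendstoUniformlyOn
        (fun (n : ℕ) (p : (Fin k → ℝ) × (Fin k → ℝ)) =>
          (b (kseq n) : ℂ) *
            (ν (fun j => p.1 j / (kseq n : ℝ)) (fun j => (a (kseq n))⁻¹ * p.2 j) - 1))
        (fun p => ψ p.1 p.2) atTop K) :
    ∀ t θ : Fin k → ℝ, (∀ j, t j ∈ T) →
      ψ (fun j => c * t j) θ =
        ((c ^ δ : ℝ) : ℂ) * ψ t (fun j => c ^ (α - δ / 2) * θ j) := by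
  intro t θ ht
  have hc0 : 0 < c := by linarith
  have hmul : ∀ r : ℝ, 0 < r → ∀ x ∈ T, r * x ∈ T := by
    rintro r hr x hx
    rcases hT with rfl | rfl | rfl
    · trivial
    · exact mul_nonneg hr.le hx
    · exact mul_pos hr hx
  have hkt := tendsto_atTop_of_tendsto_ratio hc hk
  have hkt' : Tendsto (fun n => kseq (n + 1)) atTop atTop := (tendsto_add_atTop_iff_nat 1).mpr hkt
  have hbpos : ∀ᶠ n in atTop, (0 : ℝ) < b n := by
    filter_upwards [hbRV.eventually_ne_zero] with n hn
    exact lt_of_le_of_ne (Nat.cast_nonneg _) (Ne.symm hn)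
  have hb := hbRV.tendsto_div_s13 hbpos hkt hkt' hc0 hk
  have ha := (haRV.tendsto_div_s13 (Eventually.of_forall hapos) hkt hkt' hc0 hk).inv₀
    (Real.rpow_pos_of_pos hc0 _).ne'
  rw [← Real.rpow_neg hc0.le, neg_sub] at ha
  -- The points at which the convergence along `kseq n` is evaluated.
  let q : ℕ → (Fin k → ℝ) × (Fin k → ℝ) := fun n =>
    (fun j => ((kseq (n + 1) : ℝ) / kseq n)⁻¹ * (c * t j),
      fun j => (a (kseq (n + 1)) / a (kseq n))⁻¹ * θ j)
  have hq : Tendsto q atTop (𝓝 (t, fun j => c ^ (α - δ / 2) * θ j)) := by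
    refine Tendsto.prodMk_nhds (tendsto_pi_nhds.mpr fun j => ?_)
      (tendsto_pi_nhds.mpr fun j => ha.mul_const _)
    have h := (hk.inv₀ hc0.ne').mul_const (c * t j)
    rwa [inv_mul_cancel_left₀ hc0.ne'] at h
  obtain ⟨N, hN⟩ := eventually_atTop.mp
    ((hkt.eventually_gt_atTop 0).and ((hkt'.eventually_gt_atTop 0).and (hkt.eventually hbpos)))
  have hqN := (tendsto_add_atTop_iff_nat N).mpr hq
  have hKT : ∀ p ∈ insert (t, fun j => c ^ (α - δ / 2) * θ j) (Set.range fun n => q (n + N)),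
      ∀ j, p.1 j ∈ T := by
    rintro p (rfl | ⟨n, rfl⟩) j
    · exact ht j
    · obtain ⟨h₁, h₂, -⟩ := hN (n + N) (by omega)
      exact hmul _ (by positivity) _ (hmul c hc0 _ (ht j))
  have hlim : Tendsto (fun n => (b (kseq (n + N)) : ℂ) *
      (ν (fun j => (q (n + N)).1 j / (kseq (n + N) : ℝ))
        (fun j => (a (kseq (n + N)))⁻¹ * (q (n + N)).2 j) - 1)) atTop
      (𝓝 (ψ t fun j => c ^ (α - δ / 2) * θ j)) := by
    refine TendstoUniformlyOn.tendsto_comp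
      (fun u hu => (tendsto_add_atTop_nat N).eventually
        (hconv _ hqN.isCompact_insert_range hKT u hu)) hψcont.continuousWithinAt
      (tendsto_nhdsWithin_iff.mpr ⟨hqN, Eventually.of_forall fun n => ?_⟩)
    exact Set.mem_insert_of_mem _ (Set.mem_range_self n)
  have hfix : Tendsto (fun n => (b (kseq (n + 1)) : ℂ) *
      (ν (fun j => c * t j / (kseq (n + 1) : ℝ)) (fun j => (a (kseq (n + 1)))⁻¹ * θ j) - 1)) atTop
      (𝓝 (ψ (fun j => c * t j) θ)) :=
    ((hconv {(fun j => c * t j, θ)} isCompact_singleton (by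
      rintro p rfl j
      exact hmul c hc0 _ (ht j))).tendsto_at (Set.mem_singleton _)).comp (tendsto_add_atTop_nat 1)
  have hbC : Tendsto (fun n => ((b (kseq (n + 1)) / b (kseq n) : ℝ) : ℂ)) atTop
      (𝓝 ((c ^ δ : ℝ) : ℂ)) := (Complex.continuous_ofReal.tendsto _).comp hb
  refine tendsto_nhds_unique ((tendsto_add_atTop_iff_nat N).mpr hfix)
    ((((tendsto_add_atTop_iff_nat N).mpr hbC).mul hlim).congr fun n => ?_)
  obtain ⟨h₁, h₂, h₃⟩ := hN (n + N) (by omega)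
  have hk₁ : (kseq (n + N) : ℝ) ≠ 0 := by positivity
  have hk₂ : (kseq (n + N + 1) : ℝ) ≠ 0 := by positivity
  have hb₀ : (b (kseq (n + N)) : ℂ) ≠ 0 := by exact_mod_cast h₃.ne'
  have hq₁ : (fun j => (q (n + N)).1 j / (kseq (n + N) : ℝ)) =
      fun j => c * t j / (kseq (n + N + 1) : ℝ) := by
    ext j
    simp only [q]
    field_simp
  have hq₂ : (fun j => (a (kseq (n + N)))⁻¹ * (q (n + N)).2 j) =
      fun j => (a (kseq (n + N + 1)))⁻¹ * θ j := by
    ext j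
    have := (hapos (kseq (n + N))).ne'
    have := (hapos (kseq (n + N + 1))).ne'
    simp only [q]
    field_simp
  rw [hq₁, hq₂, ← mul_assoc]
  push_cast
  rw [div_mul_cancel₀ _ hb₀]
end
end
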